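/- Let G be a connected finite simple graph and let e ∈ E(G) be an edge such that the graph G − e obtained by deleting e is connected. Then bdim(G − e) ≤ 3·bdim(G). -/

import Mathlib

open SimpleGraph

/-- `f` is a resolving broadcast of `G`: for any two distinct vertices `x, y` there is a
vertex `z` with `f z > 0` such that `min (d(x,z)) (f z + 1) ≠ min (d(y,z)) (f z + 1)`,
where distances are extended naturals (`⊤` for vertices in different components). -/
def IsResolvingBroadcast {V : Type*} (G : SimpleGraph V) (f : V → ℕ) : Prop :=
  ∀ x y : V, x ≠ y → ∃ z : V, 0 < f z ∧
    min (G.edist x z) ((f z : ℕ∞) + 1) ≠ min (G.edist y z) ((f z : ℕ∞) + 1)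

/-- The broadcast dimension of `G`: the minimum of `∑ v, f v` over all
resolving broadcasts `f` of `G`. -/
noncomputable def bdim {V : Type*} [Fintype V] (G : SimpleGraph V) : ℕ :=
  sInf {n : ℕ | ∃ f : V → ℕ, IsResolvingBroadcast G f ∧ ∑ v, f v = n}

/-- A walk of `G` from `x` to `z` can be shortened to one that either avoids the edge `uv`
or traverses it exactly once. -/
theorem edist_deleteEdges_le_walk_length {V : Type*} (G : SimpleGraph V) (u v : V) {x z : V}
    (p : G.Walk x z) :
    (G.deleteEdges {s(u, v)}).edist x z ≤ p.length ∨
    (G.deleteEdges {s(u, v)}).edist x u + (1 + (G.deleteEdges {s(u, v)}).edist v z) ≤ p.length ∨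
    (G.deleteEdges {s(u, v)}).edist x v + (1 + (G.deleteEdges {s(u, v)}).edist u z) ≤
      p.length := by
  induction p with
  | nil => simp
  | @cons x w z h p ih =>
    rw [Walk.length_cons, Nat.cast_add, Nat.cast_one]
    set H := G.deleteEdges {s(u, v)} with hH
    by_cases he : s(x, w) = s(u, v)
    · rcases Sym2.eq_iff.1 he with ⟨rfl, rfl⟩ | ⟨rfl, rfl⟩
      · simp only [edist_self, zero_add] at ih ⊢
        rcases ih with ih | ih | ih
        · right; left
          rw [add_comm]
          gcongr
        · right; left
          rw [add_comm]
          gcongr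
          exact le_trans (le_add_self.trans le_add_self) ih
        · left
          exact le_trans (le_add_self.trans ih) le_self_add
      · simp only [edist_self, zero_add] at ih ⊢
        rcases ih with ih | ih | ih
        · right; right
          rw [add_comm]
          gcongr
        · left
          exact le_trans (le_add_self.trans ih) le_self_add
        · right; right
          rw [add_comm]
          gcongr
          exact le_trans (le_add_self.trans le_add_self) ih
    · have hadj : H.Adj x w := by simpa [hH, deleteEdges_adj] using ⟨h, by simpa using he⟩
      have step (t : V) : H.edist x t ≤ H.edist w t + 1 := by
        have := H.edist_triangle (u := x) (v := w) (w := t)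
        rwa [edist_eq_one_iff_adj.2 hadj, add_comm] at this
      rcases ih with ih | ih | ih
      · exact Or.inl ((step z).trans (by gcongr))
      · refine Or.inr (Or.inl ((add_le_add_left (step u) _).trans ?_))
        rw [add_right_comm]
        gcongr
      · refine Or.inr (Or.inr ((add_le_add_left (step v) _).trans ?_))
        rw [add_right_comm]
        gcongr

theorem edist_deleteEdges_le {V : Type*} (G : SimpleGraph V) (u v x z : V) :
    (G.deleteEdges {s(u, v)}).edist x z ≤ G.edist x z ∨
    (G.deleteEdges {s(u, v)}).edist x u + (1 + (G.deleteEdges {s(u, v)}).edist v z) ≤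
      G.edist x z ∨
    (G.deleteEdges {s(u, v)}).edist x v + (1 + (G.deleteEdges {s(u, v)}).edist u z) ≤
      G.edist x z := by
  by_cases h : G.Reachable x z
  · obtain ⟨p, hp⟩ := h.exists_walk_length_eq_edist
    rw [← hp]
    exact edist_deleteEdges_le_walk_length G u v p
  · rw [edist_eq_top_of_not_reachable h]
    exact Or.inl le_top

theorem SimpleGraph.Adj.edist_le_deleteEdges {V : Type*} {G : SimpleGraph V} {u v : V}
    (huv : G.Adj u v) (x z : V) :
    G.edist x z ≤
      (G.deleteEdges {s(u, v)}).edist x u + (1 + (G.deleteEdges {s(u, v)}).edist v z) := by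
  have hle : G.deleteEdges {s(u, v)} ≤ G := deleteEdges_le _
  calc G.edist x z ≤ G.edist x u + G.edist u z := G.edist_triangle
    _ ≤ G.edist x u + (G.edist u v + G.edist v z) := by gcongr; exact G.edist_triangle
    _ = G.edist x u + (1 + G.edist v z) := by rw [edist_eq_one_iff_adj.2 huv]
    _ ≤ _ := by gcongr

theorem min_eq_min_of_le {α : Type*} [LinearOrder α] {a b m n : α} (hnm : n ≤ m)
    (h : min a m = min b m) : min a n = min b n := by
  rw [← min_eq_right hnm, ← min_assoc, ← min_assoc, h]

theorem min_add_right_le_of_min_eq {a b n : ℕ∞} (c : ℕ∞) (h : min a n = min b n) :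
    min (a + c) n ≤ min (b + c) n := by
  refine le_min ?_ (min_le_right _ _)
  rcases le_total b n with hb | hb
  · rw [min_eq_left hb] at h
    rcases le_total a n with ha | ha
    · rw [min_eq_left ha] at h
      exact h ▸ min_le_left _ _
    · rw [min_eq_right ha] at h
      exact (min_le_right _ _).trans (h ▸ le_self_add)
  · exact (min_le_right _ _).trans (hb.trans le_self_add)

/-- If truncated distances in `G - uv` to `u`, `v` and `z` do not separate `x` from `y`, then
neither does the truncated distance to `z` in `G`. -/
theorem SimpleGraph.Adj.min_edist_le_of_deleteEdges {V : Type*} {G : SimpleGraph V} {u v : V}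
    (huv : G.Adj u v) {x y z : V} {n : ℕ∞}
    (hz : min ((G.deleteEdges {s(u, v)}).edist x z) n =
      min ((G.deleteEdges {s(u, v)}).edist y z) n)
    (hu : min ((G.deleteEdges {s(u, v)}).edist x u) n =
      min ((G.deleteEdges {s(u, v)}).edist y u) n)
    (hv : min ((G.deleteEdges {s(u, v)}).edist x v) n =
      min ((G.deleteEdges {s(u, v)}).edist y v) n) :
    min (G.edist x z) n ≤ min (G.edist y z) n := by
  rcases edist_deleteEdges_le G u v y z with h | h | h
  · calc min (G.edist x z) n ≤ min ((G.deleteEdges {s(u, v)}).edist x z) n :=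
          min_le_min_right _ (edist_anti (deleteEdges_le _))
      _ ≤ _ := hz.trans_le (min_le_min_right _ h)
  · exact (min_le_min_right _ (huv.edist_le_deleteEdges x z)).trans
      ((min_add_right_le_of_min_eq _ hu).trans (min_le_min_right _ h))
  · have key := huv.symm.edist_le_deleteEdges x z
    rw [Sym2.eq_swap] at key
    exact (min_le_min_right _ key).trans
      ((min_add_right_le_of_min_eq _ hv).trans (min_le_min_right _ h))

/-- Raising a resolving broadcast of `G` to at least its largest value at both ends of an edge
gives a resolving broadcast of the graph with that edge deleted. -/
theorem IsResolvingBroadcast.deleteEdges {V : Type*} {G : SimpleGraph V} {f g : V → ℕ} {u v : V}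
    (hf : IsResolvingBroadcast G f) (huv : G.Adj u v) (hfg : ∀ z, f z ≤ g z)
    (hu : ∀ z, f z ≤ g u) (hv : ∀ z, f z ≤ g v) :
    IsResolvingBroadcast (G.deleteEdges {s(u, v)}) g := by
  intro x y hxy
  obtain ⟨z, hz, hne⟩ := hf x y hxy
  by_contra! hcon
  have trunc (w : V) (hw : f z ≤ g w) :
      min ((G.deleteEdges {s(u, v)}).edist x w) ((f z : ℕ∞) + 1) =
        min ((G.deleteEdges {s(u, v)}).edist y w) ((f z : ℕ∞) + 1) :=
    min_eq_min_of_le (by gcongr) (hcon w (hz.trans_le hw))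
  have h₁ := trunc z (hfg z)
  have h₂ := trunc u (hu z)
  have h₃ := trunc v (hv z)
  exact hne (le_antisymm (huv.min_edist_le_of_deleteEdges h₁ h₂ h₃)
    (huv.min_edist_le_of_deleteEdges h₁.symm h₂.symm h₃.symm))

theorem isResolvingBroadcast_one {V : Type*} (G : SimpleGraph V) :
    IsResolvingBroadcast G fun _ => 1 := by
  intro x y hxy
  refine ⟨x, one_pos, ?_⟩
  rw [edist_self, min_eq_left zero_le]
  exact (lt_min (edist_pos_of_ne hxy.symm) (by simp)).ne

theorem exists_isResolvingBroadcast_sum_eq_bdim {V : Type*} [Fintype V] (G : SimpleGraph V) :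
    ∃ f : V → ℕ, IsResolvingBroadcast G f ∧ ∑ v, f v = bdim G :=
  Nat.sInf_mem (s := {n : ℕ | ∃ f : V → ℕ, IsResolvingBroadcast G f ∧ ∑ v, f v = n})
    ⟨_, _, isResolvingBroadcast_one G, rfl⟩

/-- For every connected graph `G` and edge `e = uv` such that `G - e` is connected,
we have `bdim (G - e) ≤ 3 * bdim G`. -/
theorem bdim_deleteEdge_le_three_mul {V : Type*} [Fintype V] (G : SimpleGraph V)
    (u v : V) (huv : G.Adj u v) (hG : G.Connected)
    (hGe : (G.deleteEdges {s(u, v)}).Connected) :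
    bdim (G.deleteEdges {s(u, v)}) ≤ 3 * bdim G := by
  classical
  obtain ⟨f, hf, hsum⟩ := exists_isResolvingBroadcast_sum_eq_bdim G
  have hle (z : V) : f z ≤ bdim G :=
    hsum ▸ Finset.single_le_sum (fun _ _ => Nat.zero_le _) (Finset.mem_univ z)
  refine Nat.sInf_le ⟨fun z => f z + Pi.single (M := fun _ => ℕ) u (bdim G) z +
    Pi.single (M := fun _ => ℕ) v (bdim G) z, ?_, ?_⟩
  · refine hf.deleteEdges huv (fun z => by omega) (fun z => ?_) (fun z => ?_)
    · have := hle z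
      rw [Pi.single_eq_same]
      omega
    · have := hle z
      rw [Pi.single_eq_same]
      omega
  · rw [Finset.sum_add_distrib, Finset.sum_add_distrib, hsum, Finset.sum_pi_single',
      Finset.sum_pi_single', if_pos (Finset.mem_univ u), if_pos (Finset.mem_univ v)]
    ring
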